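/- arXiv:1308.5560 — 3 statements merged into one kernel-verified Lean document; each statement's English description precedes it below -/
import Mathlib

section
/- Let R = ℝ[x₁,…,xₙ], fix m ≥ 1 and natural numbers α₁,…,α_m, and let Λ be a symmetric m×m matrix with entries in R that is homogeneous of some degree D. Let v ∈ R^m be a homogeneous vector and let f, g ∈ R be homogeneous polynomials with g ∈ Σ(f). If f·v ∈ Σ(Λ), then g²·v ∈ Σ(Λ). -/
open MvPolynomial

/-- `q` is a sum of squares of polynomials. -/
def IsSOS {n : ℕ} (q : MvPolynomial (Fin n) ℝ) : Prop :=
  ∃ (s : ℕ) (g : Fin s → MvPolynomial (Fin n) ℝ), q = ∑ i, (g i) ^ 2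

/-- A vector `v ∈ R^m` is homogeneous of degree `k` (for the twists `α₁,…,α_m`) if its
`i`-th coordinate is homogeneous of degree `k − αᵢ`, and zero whenever `k < αᵢ`. -/
def IsVHomog {n m : ℕ} (α : Fin m → ℕ) (k : ℕ)
    (v : Fin m → MvPolynomial (Fin n) ℝ) : Prop :=
  ∀ i, ((v i).IsHomogeneous (k - α i) ∧ (k < α i → v i = 0))

/-- A symmetric `m×m` matrix `Λ` over `R` is homogeneous of degree `D` (for the twists
`α₁,…,α_m`) if its `(i,j)` entry is homogeneous of degree `D − αᵢ − αⱼ`, and zero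
whenever `D < αᵢ + αⱼ`. -/
def IsMatHomog {n m : ℕ} (α : Fin m → ℕ) (D : ℕ)
    (Λ : Matrix (Fin m) (Fin m) (MvPolynomial (Fin n) ℝ)) : Prop :=
  ∀ i j, ((Λ i j).IsHomogeneous (D - α i - α j) ∧ (D < α i + α j → Λ i j = 0))

/-- `Σ(Λ)`: the `R`-submodule of `R^m` generated by all homogeneous vectors `v` such that
`q·Λ = v·vᵀ + w₁·w₁ᵀ + … + w_s·w_sᵀ` for some homogeneous sum of squares `q ∈ R` and
vectors `w₁,…,w_s ∈ R^m`. -/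
noncomputable def SigmaMod {n m : ℕ} (α : Fin m → ℕ)
    (Λ : Matrix (Fin m) (Fin m) (MvPolynomial (Fin n) ℝ)) :
    Submodule (MvPolynomial (Fin n) ℝ) (Fin m → MvPolynomial (Fin n) ℝ) :=
  Submodule.span _ {v | (∃ k, IsVHomog α k v) ∧
    ∃ (q : MvPolynomial (Fin n) ℝ) (dq : ℕ), IsSOS q ∧ q.IsHomogeneous dq ∧
      ∃ (s : ℕ) (w : Fin s → (Fin m → MvPolynomial (Fin n) ℝ)),
        q • Λ = Matrix.vecMulVec v v + ∑ l, Matrix.vecMulVec (w l) (w l)}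

/-- `Σ(f)`: the ideal of `R = ℝ[x₁,…,xₙ]` generated by all homogeneous `v` such that
`q·f = v² + w₁² + … + w_s²` for some homogeneous sum of squares `q` and some `wᵢ ∈ R`. -/
noncomputable def SigmaIdeal {n : ℕ} (f : MvPolynomial (Fin n) ℝ) :
    Ideal (MvPolynomial (Fin n) ℝ) :=
  Ideal.span {v | (∃ dv, v.IsHomogeneous dv) ∧
    ∃ (q : MvPolynomial (Fin n) ℝ) (dq : ℕ), IsSOS q ∧ q.IsHomogeneous dq ∧
      ∃ (s : ℕ) (w : Fin s → MvPolynomial (Fin n) ℝ), q * f = v ^ 2 + ∑ i, (w i) ^ 2}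

theorem isSOS_iff_isSumSq {n : ℕ} {q : MvPolynomial (Fin n) ℝ} : IsSOS q ↔ IsSumSq q := by
  constructor
  · rintro ⟨s, g, rfl⟩
    exact IsSumSq.sum fun i _ => (IsSquare.sq (g i)).isSumSq
  · intro h
    induction h with
    | zero => exact ⟨0, fun _ => 0, by simp⟩
    | sq_add a _ ih =>
      obtain ⟨s, g, rfl⟩ := ih
      exact ⟨s + 1, Fin.cons a g, by simp [Fin.sum_univ_succ, sq]⟩

/-- The symmetric matrices that are sums of matrices `w·wᵀ`. -/
def sosMatrices (ι A : Type*) [CommRing A] : AddSubmonoid (Matrix ι ι A) :=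
  AddSubmonoid.closure (Set.range fun w : ι → A => Matrix.vecMulVec w w)

section SosMatrices

variable {ι A : Type*} [CommRing A]

theorem vecMulVec_mem_sosMatrices (w : ι → A) : Matrix.vecMulVec w w ∈ sosMatrices ι A :=
  AddSubmonoid.subset_closure ⟨w, rfl⟩

theorem mem_sosMatrices_iff {M : Matrix ι ι A} :
    M ∈ sosMatrices ι A ↔
      ∃ (s : ℕ) (w : Fin s → ι → A), M = ∑ l, Matrix.vecMulVec (w l) (w l) := by
  constructor
  · intro h
    induction h using AddSubmonoid.closure_induction_left with
    | zero => exact ⟨0, fun _ => 0, by simp⟩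
    | add_left x hx y _ ih =>
      obtain ⟨u, rfl⟩ := hx
      obtain ⟨s, w, rfl⟩ := ih
      exact ⟨s + 1, Fin.cons u w, by simp [Fin.sum_univ_succ]⟩
  · rintro ⟨s, w, rfl⟩
    exact sum_mem fun l _ => vecMulVec_mem_sosMatrices (w l)

theorem IsSumSq.smul_mem_sosMatrices {p : A} (hp : IsSumSq p) {M : Matrix ι ι A}
    (hM : M ∈ sosMatrices ι A) : p • M ∈ sosMatrices ι A := by
  induction hp with
  | zero => simp
  | sq_add a _ ih =>
    rw [add_smul]
    refine add_mem ?_ ih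
    obtain ⟨s, w, rfl⟩ := mem_sosMatrices_iff.1 hM
    rw [Finset.smul_sum]
    refine sum_mem fun l _ => ?_
    convert vecMulVec_mem_sosMatrices (a • w l) using 1
    rw [Matrix.smul_vecMulVec, Matrix.vecMulVec_smul, smul_smul]

theorem sosMatrices_apply_self {M : Matrix ι ι A} (hM : M ∈ sosMatrices ι A) (i : ι) :
    IsSumSq (M i i) := by
  obtain ⟨s, w, rfl⟩ := mem_sosMatrices_iff.1 hM
  rw [Matrix.sum_apply]
  exact IsSumSq.sum fun l _ => (IsSquare.mul_self (w l i)).isSumSq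

end SosMatrices

theorem IsSumSq.eval_nonneg {n : ℕ} {p : MvPolynomial (Fin n) ℝ} (hp : IsSumSq p)
    (x : Fin n → ℝ) : 0 ≤ eval x p := by
  induction hp with
  | zero => simp
  | sq_add a _ ih =>
    rw [map_add, map_mul]
    exact add_nonneg (mul_self_nonneg _) ih

theorem MvPolynomial.IsHomogeneous.eval_smul_eq {n e : ℕ} {p : MvPolynomial (Fin n) ℝ}
    (hp : p.IsHomogeneous e) (t : ℝ) (x : Fin n → ℝ) :
    eval (t • x) p = t ^ e * eval x p := by
  rw [eval_eq, eval_eq, Finset.mul_sum]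
  refine Finset.sum_congr rfl fun d hd => ?_
  have h : ∏ i ∈ d.support, t ^ d i = t ^ e := by
    rw [Finset.prod_pow_eq_pow_sum, hp.degree_eq_sum_deg_support hd]
  simp only [Pi.smul_apply, smul_eq_mul, mul_pow, Finset.prod_mul_distrib, h]
  ring

/-- If `b ≤ c` scales as `b t^k ≤ c t^e` for all `t ≥ 0` with `b > 0`, then the exponents agree. -/
theorem eq_of_forall_pow_mul_le {b c : ℝ} (hb : 0 < b) {k e : ℕ}
    (h : ∀ t : ℝ, 0 ≤ t → t ^ k * b ≤ t ^ e * c) : k = e := by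
  have hbc : b ≤ c := by simpa using h 1 zero_le_one
  have hc : 0 < c := hb.trans_le hbc
  rcases lt_trichotomy k e with hlt | heq | hgt
  · exfalso
    set t : ℝ := b / (2 * c) with ht
    have ht0 : 0 < t := by positivity
    have ht1 : t ≤ 1 := by rw [ht, div_le_one (by positivity)]; linarith
    have htc : t * c = b / 2 := by rw [ht]; field_simp
    have h2 : t ^ e ≤ t ^ (k + 1) := pow_le_pow_of_le_one ht0.le ht1 hlt
    have h3 : t ^ k * b ≤ t ^ k * (b / 2) := calc
      t ^ k * b ≤ t ^ e * c := h t ht0.le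
      _ ≤ t ^ (k + 1) * c := by gcongr
      _ = t ^ k * (b / 2) := by rw [pow_succ, mul_assoc, htc]
    have h4 := le_of_mul_le_mul_left h3 (pow_pos ht0 k)
    linarith
  · exact heq
  · exfalso
    set t : ℝ := c / b + 1 with ht
    have ht1 : 1 ≤ t := by rw [ht]; linarith [div_pos hc hb]
    have htb : t * b = c + b := by rw [ht]; field_simp
    have h2 : t ^ (e + 1) ≤ t ^ k := pow_le_pow_right₀ ht1 hgt
    have h3 : t ^ e * (c + b) ≤ t ^ e * c := calc
      t ^ e * (c + b) = t ^ (e + 1) * b := by rw [pow_succ, mul_assoc, htb]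
      _ ≤ t ^ k * b := by gcongr
      _ ≤ t ^ e * c := h t (zero_le_one.trans ht1)
    have h4 := le_of_mul_le_mul_left h3 (pow_pos (zero_lt_one.trans_le ht1) e)
    linarith

/-- If a homogeneous polynomial dominates the square of a nonzero homogeneous one up to a sum of
squares, it has twice its degree. -/
theorem two_mul_degree_eq_of_isSumSq_sub {n k e : ℕ} {F v : MvPolynomial (Fin n) ℝ}
    (hF : F.IsHomogeneous e) (hv : v.IsHomogeneous k) (hv0 : v ≠ 0) (h : IsSumSq (F - v ^ 2)) :
    2 * k = e := by
  obtain ⟨x, hx⟩ : ∃ x, eval x v ≠ 0 := by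
    by_contra! hcon
    exact hv0 (MvPolynomial.funext fun x => by simp [hcon x])
  refine eq_of_forall_pow_mul_le (b := eval x v ^ 2) (c := eval x F) (by positivity)
    fun t _ => ?_
  have := h.eval_nonneg (t • x)
  rw [map_sub, map_pow, hF.eval_smul_eq, hv.eval_smul_eq] at this
  calc t ^ (2 * k) * eval x v ^ 2 = (t ^ k * eval x v) ^ 2 := by ring
    _ ≤ _ := by linarith

section VHomog

variable {n m : ℕ} {α : Fin m → ℕ} {k : ℕ} {v w : Fin m → MvPolynomial (Fin n) ℝ}

theorem IsVHomog.zero (α : Fin m → ℕ) (k : ℕ) :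
    IsVHomog α k (0 : Fin m → MvPolynomial (Fin n) ℝ) :=
  fun _ => ⟨isHomogeneous_zero _ _ _, fun _ => rfl⟩

theorem IsVHomog.add (hv : IsVHomog α k v) (hw : IsVHomog α k w) : IsVHomog α k (v + w) :=
  fun i => ⟨(hv i).1.add (hw i).1, fun h => by simp [(hv i).2 h, (hw i).2 h]⟩

theorem IsVHomog.smul (hv : IsVHomog α k v) {p : MvPolynomial (Fin n) ℝ} {l : ℕ}
    (hp : p.IsHomogeneous l) : IsVHomog α (l + k) (p • v) := by
  refine fun i => ⟨?_, fun h => by simp [(hv i).2 (by omega)]⟩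
  by_cases hi : k < α i
  · simpa [(hv i).2 hi] using isHomogeneous_zero _ _ _
  · rw [show l + k - α i = l + (k - α i) by omega]
    exact hp.mul (hv i).1

/-- The degree `k` part of a vector of polynomials, for the twists `α`. -/
noncomputable def vComponent (α : Fin m → ℕ) (k : ℕ) (v : Fin m → MvPolynomial (Fin n) ℝ) :
    Fin m → MvPolynomial (Fin n) ℝ :=
  fun i => if k < α i then 0 else homogeneousComponent (k - α i) (v i)

theorem vComponent_zero (α : Fin m → ℕ) (k : ℕ) :
    vComponent α k (0 : Fin m → MvPolynomial (Fin n) ℝ) = 0 := by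
  funext i
  simp [vComponent]

theorem vComponent_add (v w : Fin m → MvPolynomial (Fin n) ℝ) :
    vComponent α k (v + w) = vComponent α k v + vComponent α k w := by
  funext i
  by_cases hi : k < α i <;> simp [vComponent, hi]

theorem IsVHomog.vComponent_eq (hv : IsVHomog α k v) (k' : ℕ) :
    vComponent α k' v = if k' = k then v else 0 := by
  funext i
  by_cases hi : k < α i
  · split_ifs <;> simp [vComponent, (hv i).2 hi]
  · by_cases hi' : k' < α i
    · simp [vComponent, hi', show k' ≠ k by omega]
    · have h := homogeneousComponent_of_mem (m := k' - α i) (hv i).1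
      simp only [vComponent, hi', if_false, h]
      by_cases hk : k' = k
      · simp [hk]
      · simp [hk, show k' - α i ≠ k - α i by omega]

end VHomog

/-- `h` is homogeneous of degree `k` and `q·Λ - h·hᵀ` is a sum of matrices `w·wᵀ`, for some
homogeneous sum of squares `q` of degree `2k - D`. -/
def IsSigmaVec {n m : ℕ} (α : Fin m → ℕ) (D : ℕ)
    (Λ : Matrix (Fin m) (Fin m) (MvPolynomial (Fin n) ℝ)) (k : ℕ)
    (h : Fin m → MvPolynomial (Fin n) ℝ) : Prop :=
  IsVHomog α k h ∧ ∃ q : MvPolynomial (Fin n) ℝ, IsSumSq q ∧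
    (q = 0 ∨ ∃ e, q.IsHomogeneous e ∧ e + D = 2 * k) ∧
    q • Λ - Matrix.vecMulVec h h ∈ sosMatrices (Fin m) (MvPolynomial (Fin n) ℝ)

section SigmaVec

variable {n m : ℕ} {α : Fin m → ℕ} {D : ℕ}
  {Λ : Matrix (Fin m) (Fin m) (MvPolynomial (Fin n) ℝ)} {k : ℕ}
  {v w : Fin m → MvPolynomial (Fin n) ℝ}

theorem IsSigmaVec.zero (α : Fin m → ℕ) (D : ℕ)
    (Λ : Matrix (Fin m) (Fin m) (MvPolynomial (Fin n) ℝ)) (k : ℕ) : IsSigmaVec α D Λ k 0 :=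
  ⟨IsVHomog.zero α k, 0, IsSumSq.zero, Or.inl rfl, by simp⟩

theorem IsSigmaVec.add (hv : IsSigmaVec α D Λ k v) (hw : IsSigmaVec α D Λ k w) :
    IsSigmaVec α D Λ k (v + w) := by
  obtain ⟨hvk, p, hp, hpd, hpm⟩ := hv
  obtain ⟨hwk, q, hq, hqd, hqm⟩ := hw
  refine ⟨hvk.add hwk, (p + q) + (p + q), (hp.add hq).add (hp.add hq), ?_, ?_⟩
  · have hsum : p + q = 0 ∨ ∃ e, (p + q).IsHomogeneous e ∧ e + D = 2 * k := by
      rcases hpd with rfl | ⟨e, he, hed⟩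
      · simpa using hqd
      rcases hqd with rfl | ⟨e', he', hed'⟩
      · exact Or.inr ⟨e, by simpa using he, hed⟩
      · obtain rfl : e = e' := by omega
        exact Or.inr ⟨e, he.add he', hed⟩
    rcases hsum with h | ⟨e, he, hed⟩
    · exact Or.inl (by rw [h, add_zero])
    · exact Or.inr ⟨e, he.add he, hed⟩
  · have h := add_mem (add_mem (add_mem hpm hqm) (add_mem hpm hqm))
      (vecMulVec_mem_sosMatrices (v - w))
    convert h using 1
    ext1 i j
    simp only [Matrix.add_apply, Matrix.sub_apply, Matrix.smul_apply, Matrix.vecMulVec_apply,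
      Pi.add_apply, Pi.sub_apply, smul_eq_mul]
    ring

theorem IsSigmaVec.smul (hv : IsSigmaVec α D Λ k v) {a : MvPolynomial (Fin n) ℝ} {l : ℕ}
    (ha : a.IsHomogeneous l) : IsSigmaVec α D Λ (l + k) (a • v) := by
  obtain ⟨hvk, p, hp, hpd, hpm⟩ := hv
  have ha2 : IsSumSq (a * a) := (IsSquare.mul_self a).isSumSq
  refine ⟨hvk.smul ha, a * a * p, ha2.mul hp, ?_, ?_⟩
  · rcases hpd with rfl | ⟨e, he, hed⟩
    · simp
    · exact Or.inr ⟨l + l + e, (ha.mul ha).mul he, by omega⟩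
  · convert ha2.smul_mem_sosMatrices hpm using 1
    ext1 i j
    simp only [Matrix.sub_apply, Matrix.smul_apply, Matrix.vecMulVec_apply, Pi.smul_apply,
      smul_eq_mul]
    ring

theorem IsSigmaVec.of_generator (hΛ : IsMatHomog α D Λ) (hv : IsVHomog α k v)
    {q : MvPolynomial (Fin n) ℝ} {d : ℕ} (hq : IsSumSq q) (hqd : q.IsHomogeneous d)
    (h : q • Λ - Matrix.vecMulVec v v ∈ sosMatrices (Fin m) (MvPolynomial (Fin n) ℝ)) :
    IsSigmaVec α D Λ k v := by
  by_cases hv0 : v = 0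
  · subst hv0
    exact IsSigmaVec.zero α D Λ k
  obtain ⟨j, hj⟩ := Function.ne_iff.1 hv0
  have hsub : IsSumSq (q * Λ j j - v j ^ 2) := by
    simpa [Matrix.vecMulVec_apply, sq] using sosMatrices_apply_self h j
  have hkj : ¬ k < α j := fun hlt => hj ((hv j).2 hlt)
  have hΛj : Λ j j ≠ 0 := by
    intro h0
    have := two_mul_degree_eq_of_isSumSq_sub (e := 2 * (k - α j) + 1)
      (by simpa [h0] using isHomogeneous_zero _ _ _) (hv j).1 hj hsub
    omega
  have hDj : ¬ D < α j + α j := fun hlt => hΛj ((hΛ j j).2 hlt)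
  have hdeg := two_mul_degree_eq_of_isSumSq_sub (hqd.mul (hΛ j j).1) (hv j).1 hj hsub
  exact ⟨hv, q, hq, Or.inr ⟨d, hqd, by omega⟩, h⟩

/-- Every homogeneous component of an element of `Σ(Λ)` satisfies a single identity of the kind
required of the generators. -/
theorem isSigmaVec_vComponent (hΛ : IsMatHomog α D Λ) {x : Fin m → MvPolynomial (Fin n) ℝ}
    (hx : x ∈ SigmaMod α Λ) (k : ℕ) : IsSigmaVec α D Λ k (vComponent α k x) := by
  let P : AddSubmonoid (Fin m → MvPolynomial (Fin n) ℝ) :=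
    { carrier := {x | ∀ k, IsSigmaVec α D Λ k (vComponent α k x)}
      zero_mem' := fun k => by
        rw [vComponent_zero]
        exact IsSigmaVec.zero α D Λ k
      add_mem' := fun hx hy k => by
        rw [vComponent_add]
        exact (hx k).add (hy k) }
  obtain ⟨N, a, u, rfl⟩ := Submodule.mem_span_set'.1 hx
  suffices h : ∑ i, a i • (u i : Fin m → MvPolynomial (Fin n) ℝ) ∈ P from h k
  refine sum_mem fun i _ => ?_
  obtain ⟨⟨d, hd⟩, q, dq, hq, hqd, s, w, hw⟩ := (u i).2
  have hu : IsSigmaVec α D Λ d (u i) :=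
    IsSigmaVec.of_generator hΛ hd (isSOS_iff_isSumSq.1 hq) hqd
      (mem_sosMatrices_iff.2 ⟨s, w, by rw [hw, add_sub_cancel_left]⟩)
  rw [← sum_homogeneousComponent (a i), Finset.sum_smul]
  refine sum_mem fun l _ k => ?_
  have hl := hu.smul (homogeneousComponent_isHomogeneous l (a i))
  rw [hl.1.vComponent_eq]
  split_ifs with hk
  · rwa [hk]
  · exact IsSigmaVec.zero α D Λ k

theorem IsSigmaVec.of_mem (hΛ : IsMatHomog α D Λ) (hv : IsVHomog α k v)
    (hmem : v ∈ SigmaMod α Λ) : IsSigmaVec α D Λ k v := by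
  simpa [hv.vComponent_eq] using isSigmaVec_vComponent hΛ hmem k

theorem IsSigmaVec.mem (hv : IsSigmaVec α D Λ k v) : v ∈ SigmaMod α Λ := by
  obtain ⟨hvk, q, hq, hqd, hqm⟩ := hv
  obtain ⟨d, hd⟩ : ∃ d, q.IsHomogeneous d := by
    rcases hqd with rfl | ⟨e, he, -⟩
    · exact ⟨0, isHomogeneous_zero _ _ _⟩
    · exact ⟨e, he⟩
  obtain ⟨s, w, hw⟩ := mem_sosMatrices_iff.1 hqm
  exact Submodule.subset_span
    ⟨⟨k, hvk⟩, q, d, isSOS_iff_isSumSq.2 hq, hd, s, w, by rw [← hw, add_sub_cancel]⟩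

end SigmaVec

/-- `Σ(f)` is contained in `Σ` of the `1×1` matrix with entry `f`. -/
theorem const_mem_sigmaMod_of_mem_sigmaIdeal {n : ℕ} {f g : MvPolynomial (Fin n) ℝ}
    (hg : g ∈ SigmaIdeal f) :
    (fun _ => g) ∈ SigmaMod (fun _ : Fin 1 => 0) (Matrix.of fun _ _ => f) := by
  induction hg using Submodule.span_induction with
  | mem v hv =>
    obtain ⟨⟨d, hd⟩, q, dq, hq, hqd, s, w, hw⟩ := hv
    refine Submodule.subset_span
      ⟨⟨d, fun _ => ⟨hd, by simp⟩⟩, q, dq, hq, hqd, s, fun l _ => w l, ?_⟩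
    ext1 i j
    simp [Matrix.sum_apply, Matrix.vecMulVec_apply, hw, sq]
  | zero => exact zero_mem _
  | add x y _ _ hx hy => exact add_mem hx hy
  | smul a x _ hx => exact Submodule.smul_mem _ a hx

theorem exists_isSumSq_mul_sub_sq_of_mem_sigmaIdeal {n df dg : ℕ}
    {f g : MvPolynomial (Fin n) ℝ} (hf : f.IsHomogeneous df) (hg : g.IsHomogeneous dg)
    (hgf : g ∈ SigmaIdeal f) :
    ∃ p : MvPolynomial (Fin n) ℝ, (p = 0 ∨ ∃ e, p.IsHomogeneous e ∧ e + df = 2 * dg) ∧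
      IsSumSq (p * f - g ^ 2) := by
  obtain ⟨-, p, -, hpd, hpm⟩ := IsSigmaVec.of_mem (D := df) (k := dg)
    (fun _ _ => ⟨by simpa using hf, by simp⟩) (fun _ => ⟨by simpa using hg, by simp⟩)
    (const_mem_sigmaMod_of_mem_sigmaIdeal hgf)
  exact ⟨p, hpd, by simpa [Matrix.vecMulVec_apply, sq] using sosMatrices_apply_self hpm 0⟩

/-- **Lemma.** Let `Λ` be a symmetric homogeneous `m×m` matrix over `R = ℝ[x₁,…,xₙ]`,
let `v ∈ R^m` be homogeneous and `f, g ∈ R` homogeneous with `g ∈ Σ(f)`.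
If `f·v ∈ Σ(Λ)`, then `g²·v ∈ Σ(Λ)`. -/
theorem statement10 {n m : ℕ} (hm : 1 ≤ m) (α : Fin m → ℕ) (D : ℕ)
    (Λ : Matrix (Fin m) (Fin m) (MvPolynomial (Fin n) ℝ)) (hsymm : Λ.IsSymm)
    (hΛ : IsMatHomog α D Λ) (v : Fin m → MvPolynomial (Fin n) ℝ) (kv : ℕ)
    (hv : IsVHomog α kv v) (f g : MvPolynomial (Fin n) ℝ) (df dg : ℕ)
    (hf : f.IsHomogeneous df) (hg : g.IsHomogeneous dg) (hgf : g ∈ SigmaIdeal f)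
    (hfv : f • v ∈ SigmaMod α Λ) :
    g ^ 2 • v ∈ SigmaMod α Λ := by
  obtain ⟨p, hpd, hp⟩ := exists_isSumSq_mul_sub_sq_of_mem_sigmaIdeal hf hg hgf
  obtain ⟨-, q, hq, hqd, hqm⟩ := IsSigmaVec.of_mem hΛ (hv.smul hf) hfv
  have hp2 : IsSumSq (p * p) := (IsSquare.mul_self p).isSumSq
  have hg2 : IsSumSq (g ^ 2) := (IsSquare.sq g).isSumSq
  refine IsSigmaVec.mem (D := D) (k := dg * 2 + kv)
    ⟨hv.smul (hg.pow 2), p * p * q, hp2.mul hq, ?_, ?_⟩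
  · rcases hpd with rfl | ⟨e, he, hed⟩
    · simp
    rcases hqd with rfl | ⟨e', he', hed'⟩
    · simp
    · exact Or.inr ⟨e + e + e', (he.mul he).mul he', by omega⟩
  · have hmul : IsSumSq ((p * f - g ^ 2) * (p * f - g ^ 2) +
        (g ^ 2 * (p * f - g ^ 2) + g ^ 2 * (p * f - g ^ 2))) :=
      (hp.mul hp).add ((hg2.mul hp).add (hg2.mul hp))
    convert add_mem (hp2.smul_mem_sosMatrices hqm)
      (hmul.smul_mem_sosMatrices (vecMulVec_mem_sosMatrices v)) using 1
    ext1 i j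
    simp only [Matrix.add_apply, Matrix.sub_apply, Matrix.smul_apply, Matrix.vecMulVec_apply,
      Pi.smul_apply, smul_eq_mul]
    ring
end

section
/- Let R = ℝ[x₁,…,xₙ], fix m ≥ 1 and natural numbers α₁,…,α_m, and let Λ be a symmetric m×m matrix with entries in R that is homogeneous of some degree D and positive definite. Then the homogeneous ideal (Σ(Λ) : R^m) has no real projective zeros: for every 0 ≠ p ∈ ℝⁿ there exists a ∈ (Σ(Λ) : R^m) with a(p) ≠ 0. -/
open MvPolynomial

theorem MvPolynomial.prod_factorial_mul_coeff_sum_X_pow_mul_monomial {σ : Type*} [Fintype σ]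
    (N : ℕ) (α β : σ →₀ ℕ) (h : β.degree = N + α.degree) :
    (∏ i, ((β i).factorial : ℝ)) *
        coeff β ((∑ i, X i : MvPolynomial σ ℝ) ^ N * monomial α 1) =
      N.factorial * ∏ i, ((β i).descFactorial (α i) : ℝ) := by
  classical
  induction N generalizing β with
  | zero =>
    simp only [pow_zero, one_mul, coeff_monomial, Nat.factorial_zero, Nat.cast_one]
    by_cases hab : α = β
    · subst hab
      simp [Nat.descFactorial_self]
    · rw [if_neg hab, mul_zero, eq_comm, Finset.prod_eq_zero_iff]
      by_contra! hne
      have hle : α ≤ β := fun i => by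
        by_contra! hlt
        exact hne i (Finset.mem_univ i) (by exact_mod_cast Nat.descFactorial_of_lt hlt)
      apply hab
      obtain ⟨γ, rfl⟩ := exists_add_of_le hle
      have : γ.degree = 0 := by simpa using h
      simp [(Finsupp.degree_eq_zero_iff _).mp this]
  | succ N ih =>
    have key : ∀ i, (∏ j, ((β j).factorial : ℝ)) *
        coeff β (X i * ((∑ i, X i : MvPolynomial σ ℝ) ^ N * monomial α 1)) =
        N.factorial * ((∏ j, ((β j).descFactorial (α j) : ℝ)) * ((β i : ℝ) - α i)) := by
      intro i
      rw [coeff_X_mul']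
      by_cases hi : i ∈ β.support
      · obtain ⟨γ, rfl⟩ : ∃ γ, β = γ + Finsupp.single i 1 := by
          refine ⟨β - Finsupp.single i 1, (tsub_add_cancel_of_le ?_).symm⟩
          rw [Finsupp.single_le_iff]
          exact Nat.one_le_iff_ne_zero.mpr (Finsupp.mem_support_iff.mp hi)
        have hγ : γ.degree = N + α.degree := by
          simp only [map_add, Finsupp.degree_single] at h
          omega
        have ih' := ih γ hγ
        rw [if_pos hi, add_tsub_cancel_right]
        have h1 : (∏ j, (((γ + Finsupp.single i 1 : σ →₀ ℕ) j).factorial : ℝ)) =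
            (γ i + 1) * ∏ j, ((γ j).factorial : ℝ) := by
          rw [← Finset.mul_prod_erase _ _ (Finset.mem_univ i),
            ← Finset.mul_prod_erase Finset.univ (fun j => ((γ j).factorial : ℝ))
              (Finset.mem_univ i), ← mul_assoc]
          congr 1
          · simp [Nat.factorial_succ]
          · refine Finset.prod_congr rfl fun j hj => ?_
            simp [Finsupp.single_eq_of_ne (Finset.ne_of_mem_erase hj)]
        have h2 : (∏ j, (((γ + Finsupp.single i 1 : σ →₀ ℕ) j).descFactorial (α j) : ℝ)) *
            (((γ + Finsupp.single i 1 : σ →₀ ℕ) i : ℝ) - α i) =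
            (γ i + 1) * ∏ j, ((γ j).descFactorial (α j) : ℝ) := by
          rw [← Finset.mul_prod_erase _ _ (Finset.mem_univ i),
            ← Finset.mul_prod_erase Finset.univ (fun j => ((γ j).descFactorial (α j) : ℝ))
              (Finset.mem_univ i), mul_right_comm, ← mul_assoc]
          congr 1
          · have := Nat.succ_descFactorial (γ i) (α i)
            simp only [Finsupp.add_apply, Finsupp.single_eq_same]
            rcases le_or_gt (α i) (γ i + 1) with hle | hlt
            · rw [← Nat.cast_sub hle, mul_comm]
              exact_mod_cast this
            · rw [Nat.descFactorial_of_lt hlt, Nat.descFactorial_of_lt (by omega)]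
              simp
          · refine Finset.prod_congr rfl fun j hj => ?_
            simp [Finsupp.single_eq_of_ne (Finset.ne_of_mem_erase hj)]
        rw [h1, h2, mul_assoc, ih']
        ring
      · rw [if_neg hi]
        have hi0 : β i = 0 := by simpa using hi
        rcases Nat.eq_zero_or_pos (α i) with h0 | h0
        · simp [hi0, h0]
        · have hz : (∏ j, ((β j).descFactorial (α j) : ℝ)) = 0 :=
            Finset.prod_eq_zero (Finset.mem_univ i)
              (by rw [hi0, Nat.descFactorial_of_lt h0, Nat.cast_zero])
          simp [hz]
    rw [pow_succ', mul_assoc, Finset.sum_mul, coeff_sum, Finset.mul_sum,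
      Finset.sum_congr rfl fun i _ => key i, ← Finset.mul_sum, ← Finset.mul_sum,
      Finset.sum_sub_distrib]
    have : (∑ i, (β i : ℝ)) - ∑ i, (α i : ℝ) = N + 1 := by
      rw [Finsupp.degree_eq_sum, Finsupp.degree_eq_sum] at h
      have h' : (∑ i, (β i : ℝ)) = N + 1 + ∑ i, (α i : ℝ) := by exact_mod_cast h
      rw [h']
      ring
    rw [this, Nat.factorial_succ]
    push_cast
    ring

/-- **Pólya's theorem** on forms that are positive on the nonnegative orthant. -/
theorem MvPolynomial.IsHomogeneous.exists_coeff_sum_X_pow_mul_nonneg {σ : Type*} [Fintype σ]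
    {F : MvPolynomial σ ℝ} {d : ℕ} (hF : F.IsHomogeneous d)
    (hpos : ∀ y : σ → ℝ, (∀ i, 0 ≤ y i) → y ≠ 0 → 0 < eval y F) :
    ∃ N : ℕ, ∀ β, 0 ≤ coeff β ((∑ i, X i : MvPolynomial σ ℝ) ^ N * F) := by
  classical
  let Φ : ℝ × (σ → ℝ) → ℝ := fun z =>
    ∑ α ∈ F.support, coeff α F * ∏ i, ∏ k ∈ Finset.range (α i), (z.2 i - k * z.1)
  have hΦ : Continuous Φ := by fun_prop
  have hev : ∀ᶠ ε in nhds (0 : ℝ), ∀ y ∈ stdSimplex ℝ σ, 0 < Φ (ε, y) := by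
    refine (isCompact_stdSimplex ℝ σ).eventually_forall_of_forall_eventually fun y hy => ?_
    refine (hΦ.tendsto (0, y)).eventually (lt_mem_nhds ?_)
    have : Φ (0, y) = eval y F := by simp [Φ, eval_eq']
    rw [this]
    refine hpos y hy.1 ?_
    rintro rfl
    simpa using hy.2
  have hlim : Filter.Tendsto (fun N : ℕ => 1 / ((N + d : ℕ) : ℝ)) Filter.atTop (nhds 0) :=
    tendsto_one_div_atTop_nhds_zero_nat.comp (Filter.tendsto_add_atTop_nat d)
  obtain ⟨N, hN, hN1⟩ := ((hlim.eventually hev).and (Filter.eventually_ge_atTop 1)).exists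
  refine ⟨N, fun β => ?_⟩
  have hhom : ((∑ i, X i : MvPolynomial σ ℝ) ^ N * F).IsHomogeneous (N + d) := by
    have h1 : (∑ i, X i : MvPolynomial σ ℝ).IsHomogeneous 1 :=
      IsHomogeneous.sum _ _ _ fun i _ => isHomogeneous_X ℝ i
    simpa using (h1.pow N).mul hF
  by_cases hβ : β.degree = N + d
  swap
  · exact (hhom.coeff_eq_zero hβ).ge
  have hM : (0 : ℝ) < ((N + d : ℕ) : ℝ) := by exact_mod_cast (by omega : 0 < N + d)
  set M : ℝ := ((N + d : ℕ) : ℝ) with hMdef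
  have hfact : (0 : ℝ) < ∏ i, ((β i).factorial : ℝ) :=
    Finset.prod_pos fun i _ => by exact_mod_cast Nat.factorial_pos _
  have hsimplex : (fun i => (β i : ℝ) / M) ∈ stdSimplex ℝ σ := by
    refine ⟨fun i => by positivity, ?_⟩
    rw [← Finset.sum_div, div_eq_one_iff_eq hM.ne', hMdef, ← hβ, Finsupp.degree_eq_sum]
    push_cast
    rfl
  have hpos' := hN _ hsimplex
  have hcoeff : (∏ i, ((β i).factorial : ℝ)) *
      coeff β ((∑ i, X i : MvPolynomial σ ℝ) ^ N * F) =
      N.factorial * (M ^ d * Φ (1 / M, fun i => (β i : ℝ) / M)) := by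
    conv_lhs => rw [F.as_sum]
    simp only [Φ]
    rw [Finset.mul_sum, coeff_sum, Finset.mul_sum, Finset.mul_sum, Finset.mul_sum]
    refine Finset.sum_congr rfl fun α hα => ?_
    have hαd : α.degree = d := by
      by_contra hne
      exact (mem_support_iff.mp hα) (hF.coeff_eq_zero hne)
    have hmon : monomial α (coeff α F) = C (coeff α F) * monomial α 1 := by
      rw [C_mul_monomial, mul_one]
    have hdesc : ∀ i, ((β i).descFactorial (α i) : ℝ) =
        M ^ α i * ∏ k ∈ Finset.range (α i), ((β i : ℝ) / M - k * (1 / M)) := by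
      intro i
      rw [← descPochhammer_eval_eq_descFactorial, descPochhammer_eval_eq_prod_range,
        Finset.pow_eq_prod_const, ← Finset.prod_mul_distrib]
      refine Finset.prod_congr rfl fun k _ => ?_
      field_simp
    have hMd : M ^ d = ∏ i, M ^ α i := by
      rw [Finset.prod_pow_eq_pow_sum, ← hαd, Finsupp.degree_eq_sum]
    rw [hmon, mul_left_comm _ (C _), coeff_C_mul, mul_left_comm,
      prod_factorial_mul_coeff_sum_X_pow_mul_monomial N α β (by rw [hβ, hαd]), hMd,
      Finset.prod_congr rfl fun i _ => hdesc i, Finset.prod_mul_distrib]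
    ring
  refine nonneg_of_mul_nonneg_right ?_ hfact
  rw [hcoeff]
  positivity

theorem MvPolynomial.aeval_mul_left_of_isHomogeneous {σ R A : Type*} [Fintype σ] [CommSemiring R]
    [CommSemiring A] [Algebra R A] {f : MvPolynomial σ R} {d : ℕ} (hf : f.IsHomogeneous d)
    (c : A) (g : σ → A) : aeval (fun i => c * g i) f = c ^ d * aeval g f := by
  rw [aeval_def, aeval_def, eval₂_eq', eval₂_eq', Finset.mul_sum]
  refine Finset.sum_congr rfl fun α hα => ?_
  have hd : α.degree = d := by
    by_contra hne
    exact (mem_support_iff.mp hα) (hf.coeff_eq_zero hne)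
  have : c ^ d = ∏ i, c ^ α i := by
    rw [Finset.prod_pow_eq_pow_sum, ← hd, Finsupp.degree_eq_sum]
  simp only [mul_pow, Finset.prod_mul_distrib, ← this]
  ring

theorem MvPolynomial.eval_mul_left_of_isHomogeneous {σ R : Type*} [Fintype σ] [CommSemiring R]
    {f : MvPolynomial σ R} {d : ℕ} (hf : f.IsHomogeneous d) (c : R) (x : σ → R) :
    eval (fun i => c * x i) f = c ^ d * eval x f := by
  simpa [coe_aeval_eq_eval] using aeval_mul_left_of_isHomogeneous hf c x

/-- A form that is positive at some point and its antipode has even degree. -/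
theorem MvPolynomial.even_of_isHomogeneous_of_eval_pos {σ : Type*} [Fintype σ]
    {f : MvPolynomial σ ℝ} {d : ℕ} (hf : f.IsHomogeneous d) {x : σ → ℝ}
    (hx : 0 < eval x f) (hx' : 0 < eval (fun i => -1 * x i) f) : Even d := by
  by_contra hd
  rw [eval_mul_left_of_isHomogeneous hf, (Nat.not_even_iff_odd.mp hd).neg_one_pow] at hx'
  linarith

/-- A positive definite form becomes a sum of squares after multiplication with a suitable
positive definite sum of squares. -/
theorem MvPolynomial.exists_isSumSq_mul_of_isHomogeneous {ι : Type*} [Fintype ι]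
    {f : MvPolynomial ι ℝ} {e : ℕ} (hf : f.IsHomogeneous e)
    (hpos : ∀ x : ι → ℝ, x ≠ 0 → 0 < eval x f) {p : ι → ℝ} (hp : p ≠ 0) :
    ∃ (q : MvPolynomial ι ℝ) (d : ℕ), IsSumSq q ∧ q.IsHomogeneous d ∧
      (∀ x : ι → ℝ, x ≠ 0 → 0 < eval x q) ∧ IsSumSq (q * f) := by
  classical
  have hneg : ∀ x : ι → ℝ, x ≠ 0 → (fun i => -1 * x i) ≠ 0 := by
    intro x hx h
    exact hx (_root_.funext fun i => by simpa using congrFun h i)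
  have he : Even e := even_of_isHomogeneous_of_eval_pos hf (hpos p hp) (hpos _ (hneg p hp))
  have hnonneg : ∀ x : ι → ℝ, 0 ≤ eval x f := by
    intro x
    rcases eq_or_ne x 0 with rfl | hx
    · have : (0 : ι → ℝ) = fun i => 0 * p i := by ext; simp
      rw [this, eval_mul_left_of_isHomogeneous hf]
      exact mul_nonneg (pow_nonneg le_rfl _) (hpos p hp).le
    · exact (hpos x hx).le
  let l : ι × ι × Bool → MvPolynomial ι ℝ := fun k =>
    if k.2.2 then X k.1 + X k.2.1 else X k.1 - X k.2.1
  let s : ι × ι × Bool → MvPolynomial ι ℝ := fun k => l k ^ 2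
  have hl : ∀ k, (l k).IsHomogeneous 1 := by
    rintro ⟨i, j, b⟩
    cases b
    · simpa [l] using (isHomogeneous_X ℝ i).sub (isHomogeneous_X ℝ j)
    · simpa [l] using (isHomogeneous_X ℝ i).add (isHomogeneous_X ℝ j)
  let Z : MvPolynomial (ι × ι × Bool) ℝ := ∑ k, X k
  let F : MvPolynomial (ι × ι × Bool) ℝ :=
    ∑ i, aeval (fun j => (X (i, j, true) - X (i, j, false) : MvPolynomial (ι × ι × Bool) ℝ)) f
  let G : MvPolynomial (ι × ι × Bool) ℝ :=
    ∑ i, ∑ j, (X (i, j, true) + X (i, j, false)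
      - C (1 / 2) * (X (i, i, true) + X (j, j, true))) ^ 2
  have hZ : Z.IsHomogeneous 1 := IsHomogeneous.sum _ _ _ fun k _ => isHomogeneous_X ℝ k
  have hF : F.IsHomogeneous e := IsHomogeneous.sum _ _ _ fun i _ => by
    simpa using hf.aeval (n := 1)
      (fun j => (X (i, j, true) - X (i, j, false) : MvPolynomial (ι × ι × Bool) ℝ))
      fun j => (isHomogeneous_X ℝ _).sub (isHomogeneous_X ℝ _)
  have hG : G.IsHomogeneous 2 :=
    IsHomogeneous.sum _ _ _ fun i _ => IsHomogeneous.sum _ _ _ fun j _ =>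
      (((isHomogeneous_X ℝ _).add (isHomogeneous_X ℝ _)).sub
        (((isHomogeneous_X ℝ _).add (isHomogeneous_X ℝ _)).C_mul _)).pow 2
  have hH : (F * Z ^ 2 + G * Z ^ e).IsHomogeneous (e + 2) := by
    refine IsHomogeneous.add (by simpa using hF.mul (hZ.pow 2)) ?_
    rw [add_comm e]
    simpa using hG.mul (hZ.pow e)
  have hHpos : ∀ y : ι × ι × Bool → ℝ, (∀ k, 0 ≤ y k) → y ≠ 0 →
      0 < eval y (F * Z ^ 2 + G * Z ^ e) := by
    intro y hy hy0
    have hZy : eval y Z = ∑ k, y k := by simp [Z]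
    have hZpos : 0 < eval y Z := by
      rw [hZy]
      obtain ⟨k, hk⟩ := Function.ne_iff.mp hy0
      exact Finset.sum_pos' (fun k _ => hy k)
        ⟨k, Finset.mem_univ k, lt_of_le_of_ne (hy k) (Ne.symm hk)⟩
    have hFy : eval y F = ∑ i, eval (fun j => y (i, j, true) - y (i, j, false)) f := by
      simp only [F, map_sum]
      refine Finset.sum_congr rfl fun i _ => ?_
      rw [← aeval_eq_eval, ← aeval_eq_eval, ← AlgHom.comp_apply, comp_aeval]
      simp
    have hGy : eval y G = ∑ i, ∑ j, (y (i, j, true) + y (i, j, false)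
        - 1 / 2 * (y (i, i, true) + y (j, j, true))) ^ 2 := by
      simp [G]
    have hF0 : 0 ≤ eval y F := by
      rw [hFy]
      exact Finset.sum_nonneg fun i _ => hnonneg _
    have hG0 : 0 ≤ eval y G := by
      rw [hGy]
      exact Finset.sum_nonneg fun i _ => Finset.sum_nonneg fun j _ => sq_nonneg _
    simp only [map_add, map_mul, map_pow]
    rcases hF0.lt_or_eq with h | h
    · positivity
    rcases hG0.lt_or_eq with h' | h'
    · positivity
    exfalso
    rw [hFy, eq_comm, Finset.sum_eq_zero_iff_of_nonneg fun i _ => hnonneg _] at h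
    have hdiff : ∀ i j, y (i, j, true) = y (i, j, false) := by
      intro i j
      by_contra hne
      refine (hpos (fun j => y (i, j, true) - y (i, j, false)) ?_).ne' (h i (Finset.mem_univ i))
      exact fun h0 => hne (sub_eq_zero.mp (congrFun h0 j))
    rw [hGy, eq_comm, Finset.sum_eq_zero_iff_of_nonneg
      fun i _ => Finset.sum_nonneg fun j _ => sq_nonneg _] at h'
    have hrel : ∀ i j, y (i, j, true) + y (i, j, false)
        - 1 / 2 * (y (i, i, true) + y (j, j, true)) = 0 := by
      intro i j
      have := (Finset.sum_eq_zero_iff_of_nonneg fun j _ => sq_nonneg _).mp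
        (h' i (Finset.mem_univ i)) j (Finset.mem_univ j)
      exact pow_eq_zero_iff two_ne_zero |>.mp this
    have hdiag : ∀ i, y (i, i, true) = 0 := fun i => by
      linarith [hrel i i, hdiff i i]
    apply hy0
    ext1 k
    obtain ⟨i, j, b⟩ := k
    have h1 := hrel i j
    have h2 := hdiff i j
    rw [hdiag i, hdiag j] at h1
    cases b <;> simp only [Pi.zero_apply] <;> linarith
  obtain ⟨N, hN⟩ := hH.exists_coeff_sum_X_pow_mul_nonneg hHpos
  have hsZ : aeval s Z = ∑ k, s k := by simp [Z]
  have hsG : aeval s G = 0 := by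
    simp only [G, map_sum]
    refine Finset.sum_eq_zero fun i _ => Finset.sum_eq_zero fun j _ => ?_
    have : (C 2⁻¹ : MvPolynomial ι ℝ) * 4 = 2 := by
      rw [← map_ofNat C 4, ← map_ofNat C 2, ← C_mul]
      norm_num
    simp [s, l]
    linear_combination (-(X i ^ 2 + X j ^ 2) : MvPolynomial ι ℝ) * this
  have hsF : aeval s F = (∑ i, (4 * X i : MvPolynomial ι ℝ) ^ e) * f := by
    simp only [F, map_sum, Finset.sum_mul]
    refine Finset.sum_congr rfl fun i _ => ?_
    rw [← AlgHom.comp_apply, comp_aeval]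
    have : (fun j => aeval s (X (i, j, true) - X (i, j, false) : MvPolynomial (ι × ι × Bool) ℝ))
        = fun j => (4 * X i : MvPolynomial ι ℝ) * X j := by
      ext1 j
      simp [s, l]
      ring
    rw [this, aeval_mul_left_of_isHomogeneous hf]
    simp
  have hs : (∑ k, s k).IsHomogeneous 2 :=
    IsHomogeneous.sum _ _ _ fun k _ => by simpa using (hl k).pow 2
  refine ⟨(∑ k, s k) ^ (N + 2) * ∑ i, (4 * X i : MvPolynomial ι ℝ) ^ e, 2 * (N + 2) + 1 * e,
    ?_, ?_, ?_, ?_⟩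
  · refine IsSumSq.mul ?_ ?_
    · rw [Finset.pow_eq_prod_const]
      exact IsSumSq.prod fun _ _ => IsSumSq.sum_sq _ _
    · exact IsSumSq.sum fun i _ => (he.isSquare_pow _).isSumSq
  · refine (hs.pow _).mul (IsHomogeneous.sum _ _ _ fun i _ => IsHomogeneous.pow ?_ e)
    exact (isHomogeneous_X ℝ i).C_mul 4
  · intro x hx
    obtain ⟨i, hi⟩ := Function.ne_iff.mp hx
    simp only [map_mul, map_pow, map_sum]
    refine mul_pos (pow_pos ?_ _) ?_
    · refine Finset.sum_pos' (fun k _ => by simp only [s, map_pow]; exact sq_nonneg _)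
        ⟨(i, i, true), Finset.mem_univ _, ?_⟩
      simp only [s, l, map_pow, if_true, map_add, eval_X]
      have : x i + x i ≠ 0 := by
        rw [← two_mul]
        exact mul_ne_zero two_ne_zero hi
      positivity
    · refine Finset.sum_pos' (fun k _ => he.pow_nonneg _) ⟨i, Finset.mem_univ _, ?_⟩
      refine he.pow_pos ?_
      simpa using hi
  · have hval : (∑ k, s k) ^ (N + 2) * (∑ i, (4 * X i : MvPolynomial ι ℝ) ^ e) * f =
        aeval s (Z ^ N * (F * Z ^ 2 + G * Z ^ e)) := by
      simp only [map_mul, map_add, map_pow, hsZ, hsF, hsG]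
      ring
    rw [hval, aeval_def, eval₂_eq']
    refine IsSumSq.sum fun β _ => (IsSquare.mul ?_ ?_).isSumSq
    · exact ⟨C (Real.sqrt (coeff β (Z ^ N * (F * Z ^ 2 + G * Z ^ e)))), by
        rw [← C_mul, Real.mul_self_sqrt (hN β)]; rfl⟩
    · refine ⟨∏ k, l k ^ β k, ?_⟩
      rw [← Finset.prod_mul_distrib]
      exact Finset.prod_congr rfl fun k _ => by simp only [s]; ring

theorem Matrix.smul_mem_closure_vecMulVec_self {ι R : Type*} [CommRing R] {q : R}
    (hq : IsSumSq q) {M : Matrix ι ι R}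
    (hM : M ∈ AddSubmonoid.closure (Set.range fun w : ι → R => Matrix.vecMulVec w w)) :
    q • M ∈ AddSubmonoid.closure (Set.range fun w : ι → R => Matrix.vecMulVec w w) := by
  induction hq with
  | zero => simp
  | sq_add a _ ih =>
    rw [add_smul]
    refine add_mem ?_ ih
    clear ih
    induction hM using AddSubmonoid.closure_induction with
    | mem M hM =>
      obtain ⟨w, rfl⟩ := hM
      refine AddSubmonoid.subset_closure ⟨a • w, ?_⟩
      simp [Matrix.smul_vecMulVec, Matrix.vecMulVec_smul, mul_smul]
    | zero => simp
    | add M M' _ _ h h' =>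
      rw [smul_add]
      exact add_mem h h'

theorem Matrix.exists_eq_sum_vecMulVec_self {ι R : Type*} [CommRing R] {M : Matrix ι ι R}
    (hM : M ∈ AddSubmonoid.closure (Set.range fun w : ι → R => Matrix.vecMulVec w w)) :
    ∃ (s : ℕ) (w : Fin s → ι → R), M = ∑ l, Matrix.vecMulVec (w l) (w l) := by
  induction hM using AddSubmonoid.closure_induction with
  | mem M hM =>
    obtain ⟨w, rfl⟩ := hM
    exact ⟨1, fun _ => w, by simp⟩
  | zero => exact ⟨0, Fin.elim0, by simp⟩
  | add M M' _ _ h h' =>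
    obtain ⟨s, w, rfl⟩ := h
    obtain ⟨s', w', rfl⟩ := h'
    exact ⟨s + s', Fin.append w w', by simp [Fin.sum_univ_add]⟩

/-- `S` is a symmetric matrix of forms (with degrees given by row and column weights) that is
supported on the indices in `t`, and positive definite there. -/
structure IsPosDefFormOn {ι σ : Type*} [Fintype ι] (t : Finset ι)
    (S : Matrix ι ι (MvPolynomial σ ℝ)) : Prop where
  symm : ∀ i j, S i j = S j i
  eq_zero : ∀ i j, j ∉ t → S i j = 0
  homogeneous : ∃ d : ι → ℕ, ∀ i j, (S i j).IsHomogeneous (d i + d j)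
  pos : ∀ x : σ → ℝ, x ≠ 0 → ∀ y : ι → ℝ, (∀ i, i ∉ t → y i = 0) → y ≠ 0 →
    0 < y ⬝ᵥ (S.map (eval x)).mulVec y

/-- The Schur complement of the entry `S i i`, multiplied by `S i i`. -/
noncomputable def Matrix.pivot {ι R : Type*} [CommRing R] (S : Matrix ι ι R) (i : ι) :
    Matrix ι ι R :=
  S i i • S - Matrix.vecMulVec (S i) (S i)

theorem IsPosDefFormOn.diag_pos {ι σ : Type*} [Fintype ι] {t : Finset ι}
    {S : Matrix ι ι (MvPolynomial σ ℝ)}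
    (hS : IsPosDefFormOn t S) {i : ι} (hi : i ∈ t) {x : σ → ℝ} (hx : x ≠ 0) :
    0 < eval x (S i i) := by
  classical
  have := hS.pos x hx (Pi.single i 1)
    (fun j hj => Pi.single_eq_of_ne (ne_of_mem_of_not_mem hi hj).symm _) (by simp)
  simpa using this

theorem IsPosDefFormOn.pivot {ι σ : Type*} [Fintype ι] [DecidableEq ι] {t : Finset ι} {i : ι}
    (hi : i ∉ t) {S : Matrix ι ι (MvPolynomial σ ℝ)} (hS : IsPosDefFormOn (insert i t) S) :
    IsPosDefFormOn t (S.pivot i) where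
  symm j k := by
    simp only [Matrix.pivot, Matrix.sub_apply, Matrix.smul_apply, Matrix.vecMulVec_apply,
      hS.symm j k, mul_comm (S i j)]
  eq_zero j k hk := by
    simp only [Matrix.pivot, Matrix.sub_apply, Matrix.smul_apply, Matrix.vecMulVec_apply,
      smul_eq_mul]
    by_cases hki : k = i
    · subst hki
      rw [hS.symm j k]
      ring
    · have hk' : k ∉ insert i t := by simp [hki, hk]
      rw [hS.eq_zero j k hk', hS.eq_zero i k hk']
      ring
  homogeneous := by
    obtain ⟨d, hd⟩ := hS.homogeneous
    refine ⟨fun j => d i + d j, fun j k => ?_⟩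
    refine IsHomogeneous.sub ?_ ?_
    · have := (hd i i).mul (hd j k)
      rwa [show d i + d i + (d j + d k) = d i + d j + (d i + d k) by ring] at this
    · exact (hd i j).mul (hd i k)
  pos x hx y hyt hy := by
    have ha := hS.diag_pos (Finset.mem_insert_self i t) hx
    set A := S.map (eval x) with hA
    set a := eval x (S i i) with ha_def
    set b := A i ⬝ᵥ y with hb
    have hAsymm : A.col i = A i := by
      ext j
      simp [hA, Matrix.col_apply, hS.symm j i]
    have hval : y ⬝ᵥ ((S.pivot i).map (eval x)).mulVec y = a * (y ⬝ᵥ A.mulVec y) - b * b := by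
      have : (S.pivot i).map (eval x) = a • A - Matrix.vecMulVec (A i) (A i) := by
        ext j k
        simp [Matrix.pivot, hA, ha_def, Matrix.vecMulVec_apply]
      rw [this, Matrix.sub_mulVec, dotProduct_sub, Matrix.smul_mulVec, dotProduct_smul,
        Matrix.vecMulVec_mulVec]
      simp [hb, dotProduct_comm y]
    have hz := hS.pos x hx (a • y - b • Pi.single i 1) ?_ ?_
    · rw [← hA, Matrix.mulVec_sub, Matrix.mulVec_smul, Matrix.mulVec_smul,
        Matrix.mulVec_single_one, hAsymm] at hz
      have h1 : (Pi.single i 1 : ι → ℝ) ⬝ᵥ A.mulVec y = b := by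
        rw [single_one_dotProduct]
        rfl
      have h2 : y ⬝ᵥ A i = b := dotProduct_comm _ _
      have h3 : A i i = a := rfl
      simp only [sub_dotProduct, dotProduct_sub, smul_dotProduct, dotProduct_smul, smul_eq_mul,
        single_one_dotProduct, h2, h3] at hz
      simp only [single_one_dotProduct] at h1
      rw [h1] at hz
      rw [hval]
      refine pos_of_mul_pos_right ?_ ha.le
      linarith
    · intro j hj
      rw [Finset.mem_insert, not_or] at hj
      simp [hyt j hj.2, hj.1]
    · obtain ⟨k, hk⟩ := Function.ne_iff.mp hy
      have hki : k ≠ i := by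
        rintro rfl
        exact hk (hyt k hi)
      intro h0
      have := congrFun h0 k
      simp [hki, ha.ne'] at this
      exact hk this

theorem Matrix.smul_self_eq_vecMulVec_add_pivot {ι R : Type*} [CommRing R]
    (S : Matrix ι ι R) (i : ι) : S i i • S = Matrix.vecMulVec (S i) (S i) + S.pivot i := by
  simp [Matrix.pivot]

theorem IsPosDefFormOn.exists_smul_mem_closure_vecMulVec_self {ι σ : Type*} [Fintype ι]
    [Fintype σ] {p : σ → ℝ} (hp : p ≠ 0) {t : Finset ι}
    {S : Matrix ι ι (MvPolynomial σ ℝ)} (hS : IsPosDefFormOn t S) :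
    ∃ (q : MvPolynomial σ ℝ) (d : ℕ), IsSumSq q ∧ q.IsHomogeneous d ∧
      (∀ x : σ → ℝ, x ≠ 0 → 0 < eval x q) ∧ q • S ∈ AddSubmonoid.closure
        (Set.range fun w : ι → MvPolynomial σ ℝ => Matrix.vecMulVec w w) := by
  classical
  induction t using Finset.induction_on generalizing S with
  | empty =>
    have : S = 0 := by
      ext1 i j
      exact hS.eq_zero i j (Finset.notMem_empty j)
    exact ⟨1, 0, IsSumSq.one, isHomogeneous_one σ ℝ, by simp, by simp [this]⟩
  | insert i t hi ih =>
    obtain ⟨q, d, hq, hqd, hqpos, hqS⟩ := ih (hS.pivot hi)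
    have hdiag := fun x hx => hS.diag_pos (Finset.mem_insert_self i t) (x := x) hx
    obtain ⟨e, he⟩ := hS.homogeneous
    obtain ⟨r, c, hr, hrc, hrpos, hrS⟩ := exists_isSumSq_mul_of_isHomogeneous (he i i) hdiag hp
    refine ⟨r * S i i * q, c + (e i + e i) + d, hrS.mul hq, (hrc.mul (he i i)).mul hqd,
      fun x hx => ?_, ?_⟩
    · simpa using mul_pos (mul_pos (hrpos x hx) (hdiag x hx)) (hqpos x hx)
    · have : (r * S i i * q) • S =
          (r * q) • Matrix.vecMulVec (S i) (S i) + r • q • S.pivot i := by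
        rw [show r * S i i * q = r * q * S i i by ring, mul_smul,
          S.smul_self_eq_vecMulVec_add_pivot i, smul_add, mul_smul r q (S.pivot i)]
      rw [this]
      exact add_mem (Matrix.smul_mem_closure_vecMulVec_self (hr.mul hq)
        (AddSubmonoid.subset_closure ⟨S i, rfl⟩)) (Matrix.smul_mem_closure_vecMulVec_self hr hqS)

/-- After multiplication with a suitable sum of squares, a positive definite matrix form is a sum
of squares `v vᵀ` in which a multiple of a given row occurs. -/
theorem IsPosDefFormOn.exists_smul_eq_vecMulVec_row_add {ι σ : Type*} [Fintype ι] [DecidableEq ι]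
    [Fintype σ] {p : σ → ℝ} (hp : p ≠ 0) {S : Matrix ι ι (MvPolynomial σ ℝ)}
    (hS : IsPosDefFormOn Finset.univ S) (i : ι) :
    ∃ (g : MvPolynomial σ ℝ) (c : ℕ) (q : MvPolynomial σ ℝ) (d : ℕ), g.IsHomogeneous c ∧
      eval p g ≠ 0 ∧ IsSumSq q ∧ q.IsHomogeneous d ∧
      ∃ (s : ℕ) (w : Fin s → ι → MvPolynomial σ ℝ),
        q • S = Matrix.vecMulVec (g • S i) (g • S i) + ∑ l, Matrix.vecMulVec (w l) (w l) := by
  have hS' : IsPosDefFormOn (insert i (Finset.univ.erase i)) S := by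
    rwa [Finset.insert_erase (Finset.mem_univ i)]
  obtain ⟨q, d, hq, hqd, hqpos, hqS⟩ :=
    (hS'.pivot (Finset.notMem_erase i _)).exists_smul_mem_closure_vecMulVec_self hp
  have hdiag := fun x hx => hS.diag_pos (Finset.mem_univ i) (x := x) hx
  obtain ⟨e, he⟩ := hS.homogeneous
  obtain ⟨r, c, hr, hrc, hrpos, hrS⟩ := exists_isSumSq_mul_of_isHomogeneous (he i i) hdiag hp
  obtain ⟨s, w, hw⟩ := Matrix.exists_eq_sum_vecMulVec_self
    (Matrix.smul_mem_closure_vecMulVec_self ((hr.mul hr).mul hq) hqS)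
  refine ⟨r * q, c + d, r * S i i * (r * q * q), _, hrc.mul hqd, ?_,
    hrS.mul ((hr.mul hq).mul hq), (hrc.mul (he i i)).mul ((hrc.mul hqd).mul hqd), s, w, ?_⟩
  · simpa using ⟨(hrpos p hp).ne', (hqpos p hp).ne'⟩
  · rw [← hw, show r * S i i * (r * q * q) = r * r * q * q * S i i by ring, mul_smul,
      S.smul_self_eq_vecMulVec_add_pivot i, smul_add, Matrix.smul_vecMulVec,
      Matrix.vecMulVec_smul, ← mul_smul, ← mul_smul]
    congr 2
    ring

theorem IsSumSq.isSOS {n : ℕ} {q : MvPolynomial (Fin n) ℝ} (hq : IsSumSq q) : IsSOS q := by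
  induction hq with
  | zero => exact ⟨0, Fin.elim0, by simp⟩
  | sq_add a _ ih =>
    obtain ⟨s, g, rfl⟩ := ih
    exact ⟨s + 1, Fin.cons a g, by simp [Fin.sum_univ_succ, pow_two]⟩

theorem isPosDefFormOn_univ {n m : ℕ} {α : Fin m → ℕ} {D : ℕ}
    {Λ : Matrix (Fin m) (Fin m) (MvPolynomial (Fin n) ℝ)} (hsymm : Λ.IsSymm)
    (hΛ : IsMatHomog α D Λ)
    (hpd : ∀ p : Fin n → ℝ, p ≠ 0 → (Λ.map (eval p)).PosDef)
    {p : Fin n → ℝ} (hp : p ≠ 0) : IsPosDefFormOn Finset.univ Λ where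
  symm i j := hsymm.apply j i
  eq_zero i j hj := absurd (Finset.mem_univ j) hj
  homogeneous := by
    have hle : ∀ i, α i + α i ≤ D := fun i => by
      by_contra! h
      simpa [(hΛ i i).2 h] using (hpd p hp).diag_pos (i := i)
    have hp' : (fun i => -1 * p i) ≠ 0 := fun h =>
      hp (_root_.funext fun i => by simpa using congrFun h i)
    have heven : ∀ i, Even (D - α i - α i) := fun i =>
      even_of_isHomogeneous_of_eval_pos (hΛ i i).1 (hpd p hp).diag_pos (hpd _ hp').diag_pos
    refine ⟨fun i => (D - α i - α i) / 2, fun i j => ?_⟩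
    have : (D - α i - α i) / 2 + (D - α j - α j) / 2 = D - α i - α j := by
      obtain ⟨a, ha⟩ := heven i
      obtain ⟨b, hb⟩ := heven j
      have := hle i
      have := hle j
      omega
    rw [this]
    exact (hΛ i j).1
  pos x hx y _ hy := by simpa using (hpd x hx).dotProduct_mulVec_pos hy

/-- **Lemma.** Let `Λ` be a symmetric homogeneous `m×m` matrix over `R = ℝ[x₁,…,xₙ]`
which is positive definite. Then the homogeneous ideal `(Σ(Λ) : R^m)` has no real
projective zeros: for every `0 ≠ p ∈ ℝⁿ` there is an `a ∈ (Σ(Λ) : R^m)` with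
`a(p) ≠ 0`. -/
theorem statement12 {n m : ℕ} (hm : 1 ≤ m) (α : Fin m → ℕ) (D : ℕ)
    (Λ : Matrix (Fin m) (Fin m) (MvPolynomial (Fin n) ℝ)) (hsymm : Λ.IsSymm)
    (hΛ : IsMatHomog α D Λ)
    (hpd : ∀ p : Fin n → ℝ, p ≠ 0 → (Λ.map (eval p)).PosDef) :
    ∀ p : Fin n → ℝ, p ≠ 0 → ∃ a : MvPolynomial (Fin n) ℝ,
      (∀ u : Fin m → MvPolynomial (Fin n) ℝ, a • u ∈ SigmaMod α Λ) ∧ eval p a ≠ 0 := by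
  intro p hp
  have hS := isPosDefFormOn_univ hsymm hΛ hpd hp
  choose g c q d hg hgp hq hqd s w hw using hS.exists_smul_eq_vecMulVec_row_add hp
  have hle : ∀ i, α i + α i ≤ D := fun i => by
    by_contra! h
    simpa [(hΛ i i).2 h] using (hpd p hp).diag_pos (i := i)
  have hmem : ∀ i, g i • Λ i ∈ SigmaMod α Λ := by
    intro i
    refine Submodule.subset_span ⟨⟨c i + (D - α i), fun j => ⟨?_, fun hj => ?_⟩⟩,
      q i, d i, (hq i).isSOS, hqd i, s i, w i, hw i⟩
    · rcases lt_or_ge D (α i + α j) with h | h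
      · simp [(hΛ i j).2 h, isHomogeneous_zero]
      · rw [show c i + (D - α i) - α j = c i + (D - α i - α j) by omega]
        exact (hg i).mul (hΛ i j).1
    · have := hle i
      simp [(hΛ i j).2 (by omega)]
  refine ⟨Λ.det * ∏ i, g i, fun u => ?_, ?_⟩
  · have : (Λ.det * ∏ i, g i) • u =
        ∑ i, (Λ.adjugate.mulVec u i * ∏ k ∈ Finset.univ.erase i, g k) • (g i • Λ i) := by
      have hu : Λ.det • u = Λ.mulVec (Λ.adjugate.mulVec u) := by
        rw [Matrix.mulVec_mulVec, Matrix.mul_adjugate, Matrix.smul_mulVec, Matrix.one_mulVec]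
      rw [mul_comm, mul_smul, hu]
      ext1 j
      simp only [Pi.smul_apply, Finset.sum_apply, smul_eq_mul, Matrix.mulVec, dotProduct,
        Finset.mul_sum (s := Finset.univ) (a := ∏ i, g i)]
      refine Finset.sum_congr rfl fun i _ => ?_
      rw [← Finset.mul_prod_erase _ _ (Finset.mem_univ i), hsymm.apply i j]
      ring
    rw [this]
    exact Submodule.sum_mem _ fun i _ => Submodule.smul_mem _ _ (hmem i)
  · rw [map_mul, map_prod, RingHom.map_det]
    exact mul_ne_zero (hpd p hp).det_pos.ne' (Finset.prod_ne_zero_iff.mpr fun i _ => hgp i)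
end

section
/- Let R = ℝ[x₁,…,xₙ] and let I ⊆ R be a homogeneous ideal whose projective zero set contains no real point, i.e. for every 0 ≠ p ∈ ℝⁿ there exists f ∈ I with f(p) ≠ 0. Then there exist r ∈ ℕ and a homogeneous polynomial f ∈ I such that Σ(f) = R_{≥r}. -/
open MvPolynomial

namespace MvPolynomial

lemma IsHomogeneous.degree_eq {σ R : Type*} [CommSemiring R] {p : MvPolynomial σ R} {d : ℕ}
    (hp : p.IsHomogeneous d) {a : σ →₀ ℕ} (ha : a ∈ p.support) : a.degree = d :=
  (hp.degree_eq_sum_deg_support ha).symm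

section Polya

variable {σ : Type*} [Fintype σ]

/-- The product `∏ᵢ xᵢ (xᵢ - t) ⋯ (xᵢ - (bᵢ - 1) t)`, a deformation of the monomial `x ^ b`. -/
def fallingMonomial (t : ℝ) (x : σ → ℝ) (b : σ →₀ ℕ) : ℝ :=
  ∏ i, ∏ k ∈ Finset.range (b i), (x i - k * t)

lemma fallingMonomial_zero (x : σ → ℝ) (b : σ →₀ ℕ) :
    fallingMonomial 0 x b = ∏ i, x i ^ b i := by
  simp [fallingMonomial]

lemma fallingMonomial_smul (c t : ℝ) (x : σ → ℝ) (b : σ →₀ ℕ) :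
    fallingMonomial (c * t) (c • x) b = c ^ b.degree * fallingMonomial t x b := by
  have h (i : σ) (k : ℕ) : c * x i - k * (c * t) = c * (x i - k * t) := by ring
  simp only [fallingMonomial, Pi.smul_apply, smul_eq_mul, h, Finset.prod_mul_distrib,
    Finset.prod_const, Finset.card_range, Finset.prod_pow_eq_pow_sum, Finsupp.degree_eq_sum]

lemma fallingMonomial_one_natCast (a b : σ →₀ ℕ) :
    fallingMonomial 1 (fun i => (a i : ℝ)) b = ∏ i, ((a i).descFactorial (b i) : ℝ) := by
  refine Finset.prod_congr rfl fun i _ => ?_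
  rw [← descPochhammer_eval_eq_descFactorial, descPochhammer_eval_eq_prod_range]
  simp

lemma continuous_fallingMonomial (b : σ →₀ ℕ) :
    Continuous fun z : ℝ × (σ → ℝ) => fallingMonomial z.1 z.2 b := by
  unfold fallingMonomial
  fun_prop

lemma factorial_mul_coeff_sum_X_pow_mul_monomial (N : ℕ) (a b : σ →₀ ℕ) (c : ℝ)
    (h : a.degree = N + b.degree) :
    (∏ i, ((a i).factorial : ℝ)) * coeff a ((∑ i, X i) ^ N * monomial b c) =
      N.factorial * (c * fallingMonomial 1 (fun i => (a i : ℝ)) b) := by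
  classical
  rw [fallingMonomial_one_natCast, coeff_mul_monomial']
  split_ifs with hb
  · obtain ⟨d, rfl⟩ := exists_add_of_le hb
    have hd : d.degree = N := by
      rw [map_add] at h
      omega
    have hmult : (∏ i, (d i).factorial) * d.multinomial = N.factorial := by
      rw [← Finsupp.multinomial_of_support_subset (Finset.subset_univ d.support),
        Nat.multinomial_spec, ← Finsupp.degree_eq_sum, hd]
    have hfac : ∏ i, ((b + d) i).factorial =
        (∏ i, (d i).factorial) * ∏ i, ((b + d) i).descFactorial (b i) := by
      rw [← Finset.prod_mul_distrib]
      refine Finset.prod_congr rfl fun i _ => ?_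
      simpa using (Nat.factorial_mul_descFactorial (Nat.le_add_right (b i) (d i))).symm
    rw [add_tsub_cancel_left, coeff_sum_X_pow_of_fintype]
    have hd' : d.sum (fun _ m => m) = N := hd
    rw [if_pos hd', ← hmult]
    have hfac' := congrArg (Nat.cast : ℕ → ℝ) hfac
    push_cast at hfac' ⊢
    rw [hfac']
    ring
  · obtain ⟨i, hi⟩ : ∃ i, a i < b i := by
      by_contra! hcon
      exact hb hcon
    have h0 : ∏ i, ((a i).descFactorial (b i) : ℝ) = 0 :=
      Finset.prod_eq_zero (Finset.mem_univ i) (by simp [Nat.descFactorial_of_lt hi])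
    simp [h0]

lemma factorial_mul_coeff_sum_X_pow_mul {P : MvPolynomial σ ℝ} {d : ℕ} (hP : P.IsHomogeneous d)
    (N : ℕ) (a : σ →₀ ℕ) (ha : a.degree = N + d) :
    (∏ i, ((a i).factorial : ℝ)) * coeff a ((∑ i, X i) ^ N * P) =
      N.factorial * ∑ b ∈ P.support, coeff b P * fallingMonomial 1 (fun i => (a i : ℝ)) b := by
  conv_lhs => rw [P.as_sum]
  rw [Finset.mul_sum, coeff_sum, Finset.mul_sum, Finset.mul_sum]
  refine Finset.sum_congr rfl fun b hb => ?_
  refine factorial_mul_coeff_sum_X_pow_mul_monomial N a b _ ?_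
  rw [ha, hP.degree_eq hb]

/-- **Pólya's theorem**: multiplying a form that is positive on the nonzero points of the closed
positive orthant by a high power of the sum of the variables makes all coefficients positive. -/
theorem exists_coeff_sum_X_pow_mul_pos {P : MvPolynomial σ ℝ} {d : ℕ} (hP : P.IsHomogeneous d)
    (hpos : ∀ y : σ → ℝ, (∀ i, 0 ≤ y i) → y ≠ 0 → 0 < eval y P) :
    ∃ N : ℕ, ∀ a : σ →₀ ℕ, a.degree = N + d → 0 < coeff a ((∑ i, X i) ^ N * P) := by
  let H : ℝ → (σ → ℝ) → ℝ := fun t x => ∑ b ∈ P.support, coeff b P * fallingMonomial t x b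
  have hH : Continuous fun z : ℝ × (σ → ℝ) => H z.1 z.2 :=
    continuous_finsetSum _ fun b _ => continuous_const.mul (continuous_fallingMonomial b)
  have hH0 (x : σ → ℝ) : H 0 x = eval x P := by
    simp only [H, fallingMonomial_zero, eval_eq']
  have hev : ∀ᶠ t in nhds (0 : ℝ), ∀ x ∈ stdSimplex ℝ σ, 0 < H t x := by
    refine (isCompact_stdSimplex ℝ σ).eventually_forall_of_forall_eventually fun x hx => ?_
    refine (hH.tendsto (0, x)).eventually (lt_mem_nhds ?_)
    change 0 < H 0 x
    rw [hH0]
    refine hpos x hx.1 ?_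
    rintro rfl
    simpa using hx.2
  have hlim : Filter.Tendsto (fun M : ℕ => (1 : ℝ) / ((M : ℝ) + 1)) Filter.atTop (nhds 0) :=
    tendsto_one_div_add_atTop_nhds_zero_nat
  obtain ⟨M, hM⟩ := Filter.eventually_atTop.1 (hlim.eventually hev)
  refine ⟨M + 1, fun a ha => ?_⟩
  set c : ℝ := ((M + d : ℕ) : ℝ) + 1 with hc
  have hc0 : 0 < c := by positivity
  have hsum : ∑ i, (a i : ℝ) = c := by
    rw [← Nat.cast_sum, ← Finsupp.degree_eq_sum, ha, hc]
    push_cast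
    ring
  have hmem : (fun i => (a i : ℝ) / c) ∈ stdSimplex ℝ σ := by
    refine ⟨fun i => by positivity, ?_⟩
    rw [← Finset.sum_div, hsum, div_self hc0.ne']
  have hHpos := hM (M + d) (Nat.le_add_right M d) _ hmem
  have hscale : ∑ b ∈ P.support, coeff b P * fallingMonomial 1 (fun i => (a i : ℝ)) b =
      c ^ d * H (1 / c) (fun i => (a i : ℝ) / c) := by
    rw [Finset.mul_sum]
    refine Finset.sum_congr rfl fun b hb => ?_
    have h := fallingMonomial_smul c (1 / c) (fun i => (a i : ℝ) / c) b
    rw [hP.degree_eq hb, mul_one_div_cancel hc0.ne'] at h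
    have hx : (c • fun i => (a i : ℝ) / c) = fun i => (a i : ℝ) := by
      ext i
      simp only [Pi.smul_apply, smul_eq_mul]
      field_simp
    rw [hx] at h
    rw [h]
    ring
  have key := factorial_mul_coeff_sum_X_pow_mul hP (M + 1) a ha
  rw [hscale] at key
  refine pos_of_mul_pos_right (a := ∏ i, ((a i).factorial : ℝ)) ?_ (by positivity)
  rw [key]
  have := mul_pos (pow_pos hc0 d) hHpos
  positivity

end Polya

section Even

variable {σ : Type*}

/-- The substitution `Xᵢ ↦ ±Xᵢ` given by a choice of signs. -/
noncomputable def signChange (s : σ → ℤˣ) : MvPolynomial σ ℝ →ₐ[ℝ] MvPolynomial σ ℝ :=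
  aeval fun i => C (((s i : ℤ) : ℝ)) * X i

lemma signChange_signChange (s t : σ → ℤˣ) (p : MvPolynomial σ ℝ) :
    signChange t (signChange s p) = signChange (t * s) p := by
  rw [← AlgHom.comp_apply]
  congr 1
  ext1 i
  simp [signChange]
  ring

lemma signChange_one (p : MvPolynomial σ ℝ) : signChange 1 p = p := by
  simp [signChange]

lemma isHomogeneous_signChange (s : σ → ℤˣ) {p : MvPolynomial σ ℝ} {d : ℕ}
    (hp : p.IsHomogeneous d) : (signChange s p).IsHomogeneous d := by
  simpa only [signChange, one_mul] using hp.aeval (fun i => C (((s i : ℤ) : ℝ)) * X i)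
    (fun i => isHomogeneous_C_mul_X _ i)

lemma eval_signChange (s : σ → ℤˣ) (x : σ → ℝ) (p : MvPolynomial σ ℝ) :
    eval x (signChange s p) = eval (fun i => ((s i : ℤ) : ℝ) * x i) p := by
  rw [signChange, ← coe_aeval_eq_eval, ← coe_aeval_eq_eval]
  simp only [RingHom.coe_coe]
  rw [← AlgHom.comp_apply]
  congr 1
  ext1 i
  simp

variable [Fintype σ]

lemma coeff_signChange (s : σ → ℤˣ) (a : σ →₀ ℕ) (p : MvPolynomial σ ℝ) :
    coeff a (signChange s p) = (∏ i, (((s i : ℤ) : ℝ)) ^ a i) * coeff a p := by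
  classical
  induction p using MvPolynomial.induction_on' with
  | monomial b c =>
    have h : signChange s (monomial b c) = monomial b ((∏ i, (((s i : ℤ) : ℝ)) ^ b i) * c) := by
      rw [signChange, aeval_monomial, Finsupp.prod_fintype _ _ (by simp)]
      simp only [mul_pow, Finset.prod_mul_distrib, algebraMap_eq, ← C_pow, ← map_prod]
      rw [monomial_eq, Finsupp.prod_fintype _ _ (by simp), C_mul]
      ring
    rw [h, coeff_monomial, coeff_monomial]
    split_ifs with hab
    · rw [hab]
    · simp
  | add p q hp hq => rw [map_add, coeff_add, coeff_add, hp, hq, mul_add]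

/-- The product of all sign changes of a polynomial. -/
noncomputable def signNorm [DecidableEq σ] (p : MvPolynomial σ ℝ) : MvPolynomial σ ℝ :=
  ∏ s : σ → ℤˣ, signChange s p

variable [DecidableEq σ]

lemma signChange_signNorm (t : σ → ℤˣ) (p : MvPolynomial σ ℝ) :
    signChange t (signNorm p) = signNorm p := by
  simp only [signNorm, map_prod, signChange_signChange]
  exact Fintype.prod_equiv (Equiv.mulLeft t) _ _ fun _ => rfl

lemma dvd_signNorm (p : MvPolynomial σ ℝ) : p ∣ signNorm p := by
  conv_lhs => rw [← signChange_one p]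
  exact Finset.dvd_prod_of_mem (fun s => signChange s p) (Finset.mem_univ 1)

lemma isHomogeneous_signNorm {p : MvPolynomial σ ℝ} {d : ℕ} (hp : p.IsHomogeneous d) :
    (signNorm p).IsHomogeneous (Fintype.card (σ → ℤˣ) * d) := by
  simpa [signNorm] using IsHomogeneous.prod Finset.univ (fun s => signChange s p) (fun _ => d)
    fun s _ => isHomogeneous_signChange s hp

lemma eval_signNorm_pos {p : MvPolynomial σ ℝ} (hp : ∀ x : σ → ℝ, x ≠ 0 → 0 < eval x p)
    {x : σ → ℝ} (hx : x ≠ 0) : 0 < eval x (signNorm p) := by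
  rw [signNorm, map_prod]
  refine Finset.prod_pos fun s _ => ?_
  rw [eval_signChange]
  refine hp _ fun h => hx ?_
  ext i
  simpa using congrFun h i

lemma even_of_mem_support_signNorm {p : MvPolynomial σ ℝ} {a : σ →₀ ℕ}
    (ha : a ∈ (signNorm p).support) (i : σ) : Even (a i) := by
  by_contra hi
  rw [Nat.not_even_iff_odd] at hi
  have h := coeff_signChange (Function.update 1 i (-1)) a (signNorm p)
  have hprod : ∏ j, ((((Function.update 1 i (-1) : σ → ℤˣ) j : ℤ) : ℝ)) ^ a j = -1 := by
    rw [Finset.prod_eq_single i]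
    · simp [hi.neg_one_pow]
    · intro j _ hj
      simp [Function.update_of_ne hj]
    · simp
  rw [signChange_signNorm, hprod] at h
  exact mem_support_iff.1 ha (by linarith)

lemma exists_expand_two_eq_signNorm {p : MvPolynomial σ ℝ} {m : ℕ}
    (hp : p.IsHomogeneous (2 * m)) :
    ∃ P : MvPolynomial σ ℝ, P.IsHomogeneous (Fintype.card (σ → ℤˣ) * m) ∧
      expand 2 P = signNorm p := by
  have hhalf : ∀ a ∈ (signNorm p).support,
      2 • (a.mapRange (· / 2) (Nat.zero_div 2) : σ →₀ ℕ) = a := by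
    intro a ha
    ext i
    simpa using Nat.two_mul_div_two_of_even (even_of_mem_support_signNorm ha i)
  refine ⟨∑ a ∈ (signNorm p).support,
    monomial (a.mapRange (· / 2) (Nat.zero_div 2)) (coeff a (signNorm p)), ?_, ?_⟩
  · refine IsHomogeneous.sum _ _ _ fun a ha => isHomogeneous_monomial _ ?_
    have h1 := (isHomogeneous_signNorm hp).degree_eq ha
    have h2 := congrArg Finsupp.degree (hhalf a ha)
    rw [map_nsmul, smul_eq_mul] at h2
    have h3 : Fintype.card (σ → ℤˣ) * (2 * m) = 2 * (Fintype.card (σ → ℤˣ) * m) := by ring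
    omega
  · rw [map_sum]
    conv_rhs => rw [(signNorm p).as_sum]
    refine Finset.sum_congr rfl fun a ha => ?_
    rw [expand_monomial, hhalf a ha]

end Even

lemma isHomogeneous_expand_two {σ : Type*} {p : MvPolynomial σ ℝ} {d : ℕ}
    (hp : p.IsHomogeneous d) : (expand 2 p).IsHomogeneous (2 * d) :=
  hp.aeval (fun i => X i ^ 2) fun i => isHomogeneous_X_pow i 2

lemma isHomogeneous_sum_X {σ : Type*} [Fintype σ] :
    (∑ i, X i : MvPolynomial σ ℝ).IsHomogeneous 1 :=
  IsHomogeneous.sum _ _ _ fun i _ => isHomogeneous_X ℝ i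

/-- A homogeneous ideal without nontrivial real zeros contains a positive definite form. -/
theorem exists_posDef_form_mem {σ : Type*} [Fintype σ] {I : Ideal (MvPolynomial σ ℝ)}
    {G : Set (MvPolynomial σ ℝ)} (hG : ∀ g ∈ G, ∃ d, g.IsHomogeneous d) (hI : I = Ideal.span G)
    (hnoreal : ∀ p : σ → ℝ, p ≠ 0 → ∃ f ∈ I, eval p f ≠ 0) :
    ∃ (m : ℕ) (F : MvPolynomial σ ℝ), F ∈ I ∧ F.IsHomogeneous (2 * m) ∧
      ∀ x : σ → ℝ, x ≠ 0 → 0 < eval x F := by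
  classical
  obtain ⟨T, hTG, hT⟩ := (Submodule.fg_span_iff_fg_span_finset_subset G).1
    (IsNoetherian.noetherian (Ideal.span G))
  choose! d hd using hG
  let m := T.sup d
  refine ⟨m, ∑ g ∈ T, g ^ 2 * (∑ i, X i ^ 2) ^ (m - d g), ?_, ?_, ?_⟩
  · refine Ideal.sum_mem _ fun g hg => Ideal.mul_mem_right _ _ (Ideal.pow_mem_of_mem _ ?_ 2 two_pos)
    rw [hI]
    exact Ideal.subset_span (hTG hg)
  · refine IsHomogeneous.sum _ _ _ fun g hg => ?_
    have h1 : (∑ i, X i ^ 2 : MvPolynomial σ ℝ).IsHomogeneous 2 :=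
      IsHomogeneous.sum _ _ _ fun i _ => isHomogeneous_X_pow i 2
    have h2 := ((hd g (hTG hg)).pow 2).mul (h1.pow (m - d g))
    have hle : d g ≤ m := Finset.le_sup hg
    convert h2 using 1
    omega
  · intro x hx
    have hs : 0 < ∑ i, x i ^ 2 := by
      obtain ⟨i, hi⟩ := Function.ne_iff.1 hx
      exact Finset.sum_pos' (fun j _ => sq_nonneg _) 
        ⟨i, Finset.mem_univ i, by simpa using sq_pos_of_ne_zero hi⟩
    simp only [map_sum, map_mul, map_pow, eval_X]
    obtain ⟨g, hg, hgx⟩ : ∃ g ∈ T, eval x g ≠ 0 := by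
      by_contra! hcon
      obtain ⟨f, hf, hfx⟩ := hnoreal x hx
      have hle : Ideal.span (T : Set (MvPolynomial σ ℝ)) ≤ RingHom.ker (eval x) :=
        Ideal.span_le.2 fun g hg => hcon g hg
      rw [hI] at hf
      change f ∈ Submodule.span _ G at hf
      rw [hT] at hf
      exact hfx (hle hf)
    refine Finset.sum_pos' (fun g _ => by positivity) ⟨g, hg, ?_⟩
    have := sq_pos_of_ne_zero hgx
    positivity

lemma mem_pow_idealOfVars_iff_homogeneousComponent {σ : Type*} (r : ℕ) (g : MvPolynomial σ ℝ) :
    g ∈ idealOfVars σ ℝ ^ r ↔ ∀ i < r, homogeneousComponent i g = 0 := by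
  rw [mem_pow_idealOfVars_iff']
  constructor
  · intro h i hi
    ext a
    rw [coeff_homogeneousComponent, coeff_zero]
    split_ifs with ha
    · exact h a (by omega)
    · rfl
  · intro h a ha
    simpa [coeff_homogeneousComponent] using congrArg (coeff a) (h _ ha)

lemma IsHomogeneous.eval_smul {σ : Type*} {p : MvPolynomial σ ℝ} {d : ℕ}
    (hp : p.IsHomogeneous d) (t : ℝ) (x : σ → ℝ) : eval (t • x) p = t ^ d * eval x p := by
  rw [eval_eq, eval_eq, Finset.mul_sum]
  refine Finset.sum_congr rfl fun a ha => ?_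
  have hd : d = ∑ i ∈ a.support, a i := hp.degree_eq_sum_deg_support ha
  simp only [Pi.smul_apply, smul_eq_mul, mul_pow, Finset.prod_mul_distrib,
    Finset.prod_pow_eq_pow_sum, ← hd]
  ring

/-- If `v² ≤ p` pointwise for forms `v ≠ 0` and `p`, then `deg p ≤ 2 deg v`. -/
lemma IsHomogeneous.le_two_mul_of_sq_le {σ : Type*} {v p : MvPolynomial σ ℝ} {d e : ℕ}
    (hv : v.IsHomogeneous d) (hp : p.IsHomogeneous e) (hv0 : v ≠ 0)
    (hle : ∀ x : σ → ℝ, eval x v ^ 2 ≤ eval x p) : e ≤ 2 * d := by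
  by_contra! hlt
  obtain ⟨x, hx⟩ : ∃ x, eval x v ≠ 0 := by
    by_contra! hcon
    exact hv0 (MvPolynomial.funext fun x => by simpa using hcon x)
  obtain ⟨k, rfl⟩ := Nat.exists_eq_add_of_lt hlt
  have hbound (t : ℝ) (ht : 0 < t) : eval x v ^ 2 ≤ t ^ (k + 1) * eval x p := by
    have h := hle (t • x)
    rw [hv.eval_smul, hp.eval_smul] at h
    have ht' : 0 < t ^ (2 * d) := pow_pos ht _
    refine le_of_mul_le_mul_left ?_ ht'
    calc t ^ (2 * d) * eval x v ^ 2 = (t ^ d * eval x v) ^ 2 := by ring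
      _ ≤ _ := h
      _ = _ := by ring
  have hlim : Filter.Tendsto (fun t : ℝ => t ^ (k + 1) * eval x p)
      (nhdsWithin 0 (Set.Ioi 0)) (nhds 0) := by
    have hc : Continuous fun t : ℝ => t ^ (k + 1) * eval x p := by fun_prop
    simpa using (hc.tendsto 0).mono_left nhdsWithin_le_nhds
  have h0 : eval x v ^ 2 ≤ 0 :=
    ge_of_tendsto hlim (Filter.eventually_of_mem self_mem_nhdsWithin hbound)
  exact hx (pow_eq_zero_iff two_ne_zero |>.1 (le_antisymm h0 (sq_nonneg _)))

end MvPolynomial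

lemma IsSOS.one {n : ℕ} : IsSOS (1 : MvPolynomial (Fin n) ℝ) :=
  ⟨1, fun _ => 1, by simp⟩

lemma SigmaIdeal_le_pow_idealOfVars {n r : ℕ} {f : MvPolynomial (Fin n) ℝ}
    (hf : f.IsHomogeneous (2 * r)) : SigmaIdeal f ≤ idealOfVars (Fin n) ℝ ^ r := by
  refine Ideal.span_le.2 ?_
  rintro v ⟨⟨d, hv⟩, q, e, -, hq, s, w, h⟩
  by_cases hv0 : v = 0
  · simp [hv0]
  have hdeg := hv.le_two_mul_of_sq_le (hq.mul hf) hv0 fun x => by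
    rw [h]
    simp only [map_add, map_sum, map_pow]
    exact le_add_of_nonneg_right (Finset.sum_nonneg fun i _ => sq_nonneg _)
  refine (mem_pow_idealOfVars_iff r v).2 fun a ha => ?_
  have := hv.degree_eq ha
  omega

lemma monomial_mem_SigmaIdeal_expand_two {n : ℕ} {Q : MvPolynomial (Fin n) ℝ}
    (hQ : ∀ a ∈ Q.support, 0 < coeff a Q) {a : Fin n →₀ ℕ} (ha : a ∈ Q.support) :
    monomial a 1 ∈ SigmaIdeal (expand 2 Q) := by
  classical
  have hpos := hQ a ha
  have hmem : monomial a √(coeff a Q) ∈ SigmaIdeal (expand 2 Q) := by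
    refine Ideal.subset_span ⟨⟨_, isHomogeneous_monomial _ rfl⟩, 1, 0, IsSOS.one,
      isHomogeneous_one _ _, (Q.support.erase a).card,
      fun i => monomial ((Q.support.erase a).equivFin.symm i : Fin n →₀ ℕ)
        √(coeff ((Q.support.erase a).equivFin.symm i : Fin n →₀ ℕ) Q), ?_⟩
    rw [Equiv.sum_comp (Q.support.erase a).equivFin.symm
        fun b => monomial (b : Fin n →₀ ℕ) √(coeff (b : Fin n →₀ ℕ) Q) ^ 2,
      Finset.sum_coe_sort (Q.support.erase a) fun b => monomial b √(coeff b Q) ^ 2,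
      Finset.add_sum_erase _ (fun b => monomial b √(coeff b Q) ^ 2) ha, one_mul]
    conv_lhs => rw [Q.as_sum]
    rw [map_sum]
    refine Finset.sum_congr rfl fun b hb => ?_
    rw [expand_monomial, monomial_pow, Real.sq_sqrt (hQ b hb).le]
  have hscale := Ideal.mul_mem_left (SigmaIdeal (expand 2 Q)) (C (√(coeff a Q))⁻¹) hmem
  rwa [C_mul_monomial, inv_mul_cancel₀ (Real.sqrt_pos.2 hpos).ne'] at hscale

lemma SigmaIdeal_expand_two {n r : ℕ} {Q : MvPolynomial (Fin n) ℝ} (hQ : Q.IsHomogeneous r)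
    (hpos : ∀ a : Fin n →₀ ℕ, a.degree = r → 0 < coeff a Q) :
    SigmaIdeal (expand 2 Q) = idealOfVars (Fin n) ℝ ^ r := by
  refine le_antisymm (SigmaIdeal_le_pow_idealOfVars (isHomogeneous_expand_two hQ)) ?_
  rw [pow_idealOfVars_eq_span, Ideal.span_le]
  rintro _ ⟨a, ha, rfl⟩
  exact monomial_mem_SigmaIdeal_expand_two
    (fun b hb => hpos b (hQ.degree_eq hb))
    (mem_support_iff.2 (hpos a ha).ne')

/-- **Corollary.** Let `I ⊆ R = ℝ[x₁,…,xₙ]` be a homogeneous ideal (i.e. generated by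
homogeneous polynomials) whose projective zero set contains no real point. Then there are
`r ∈ ℕ` and a homogeneous `f ∈ I` with `Σ(f) = R_{≥r}` (the set of polynomials all of
whose nonzero homogeneous components have degree `≥ r`). -/
theorem statement13 {n : ℕ} (I : Ideal (MvPolynomial (Fin n) ℝ))
    (hIhom : ∃ G : Set (MvPolynomial (Fin n) ℝ),
      (∀ g ∈ G, ∃ dg, g.IsHomogeneous dg) ∧ I = Ideal.span G)
    (hnoreal : ∀ p : Fin n → ℝ, p ≠ 0 → ∃ f ∈ I, eval p f ≠ 0) :
    ∃ (r : ℕ) (f : MvPolynomial (Fin n) ℝ) (df : ℕ), f ∈ I ∧ f.IsHomogeneous df ∧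
      (SigmaIdeal f : Set (MvPolynomial (Fin n) ℝ)) =
        {g | ∀ i < r, homogeneousComponent i g = 0} := by
  obtain ⟨G, hG, hI⟩ := hIhom
  obtain ⟨m, F, hFI, hF, hFpos⟩ := exists_posDef_form_mem hG hI hnoreal
  obtain ⟨P, hP, hPF⟩ := exists_expand_two_eq_signNorm hF
  have hPpos (y : Fin n → ℝ) (hy : ∀ i, 0 ≤ y i) (hy0 : y ≠ 0) : 0 < eval y P := by
    have hsq : (fun i => √(y i)) ^ 2 = y := funext fun i => Real.sq_sqrt (hy i)
    rw [← hsq, ← eval_expand, hPF]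
    refine eval_signNorm_pos hFpos fun h => hy0 ?_
    rw [← hsq, h, zero_pow two_ne_zero]
  obtain ⟨N, hN⟩ := exists_coeff_sum_X_pow_mul_pos hP hPpos
  have hQ : ((∑ i, X i) ^ N * P).IsHomogeneous (N + Fintype.card (Fin n → ℤˣ) * m) := by
    simpa using (isHomogeneous_sum_X.pow N).mul hP
  have hf := isHomogeneous_expand_two hQ
  refine ⟨N + Fintype.card (Fin n → ℤˣ) * m, expand 2 ((∑ i, X i) ^ N * P), _, ?_, hf, ?_⟩
  · rw [map_mul, hPF]
    exact I.mul_mem_left _ (I.mem_of_dvd (dvd_signNorm F) hFI)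
  · rw [SigmaIdeal_expand_two hQ hN]
    ext g
    exact mem_pow_idealOfVars_iff_homogeneousComponent _ g
end
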